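/- The set {z ∈ ℂ | conj(z) · (z² − 1/2) = z − 1/30} is finite and has exactly 5 elements. -/

import Mathlib

/-- Two distinct zeros of `30 x³ - 45 x + 1` have `30 (x² + x y + y²) = 45`. -/
lemma cubic_divided_difference {x y : ℝ} (hx : 30 * x ^ 3 - 45 * x + 1 = 0)
    (hy : 30 * y ^ 3 - 45 * y + 1 = 0) (h : x ≠ y) :
    30 * (x ^ 2 + x * y + y ^ 2) = 45 := by
  apply mul_left_cancel₀ (sub_ne_zero.2 h)
  linear_combination hx - hy

/-- Three distinct zeros of `30 x³ - 45 x + 1` sum to zero. -/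
lemma cubic_roots_sum {x y z : ℝ} (hx : 30 * x ^ 3 - 45 * x + 1 = 0)
    (hy : 30 * y ^ 3 - 45 * y + 1 = 0) (hz : 30 * z ^ 3 - 45 * z + 1 = 0)
    (hxy : x ≠ y) (hxz : x ≠ z) (hyz : y ≠ z) : x + y + z = 0 := by
  apply mul_left_cancel₀ (sub_ne_zero.2 hyz)
  linear_combination (cubic_divided_difference hx hy hxy -
    cubic_divided_difference hx hz hxz) / 30

lemma cubic_real_roots : ∃ a b c : ℝ, a < b ∧ b < c ∧
    ∀ x : ℝ, 30 * x ^ 3 - 45 * x + 1 = 0 ↔ x = a ∨ x = b ∨ x = c := by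
  have hf : Continuous fun x : ℝ => 30 * x ^ 3 - 45 * x + 1 := by fun_prop
  obtain ⟨a, ha, ha0⟩ := intermediate_value_Ioo (show (-2 : ℝ) ≤ 0 by norm_num) hf.continuousOn
    (show (0 : ℝ) ∈ Set.Ioo _ _ by constructor <;> norm_num)
  obtain ⟨b, hb, hb0⟩ := intermediate_value_Ioo' (show (0 : ℝ) ≤ 1 by norm_num) hf.continuousOn
    (show (0 : ℝ) ∈ Set.Ioo _ _ by constructor <;> norm_num)
  obtain ⟨c, hc, hc0⟩ := intermediate_value_Ioo (show (1 : ℝ) ≤ 2 by norm_num) hf.continuousOn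
    (show (0 : ℝ) ∈ Set.Ioo _ _ by constructor <;> norm_num)
  have hab : a < b := ha.2.trans hb.1
  have hbc : b < c := hb.2.trans hc.1
  refine ⟨a, b, c, hab, hbc, fun x => ⟨fun hx => ?_, ?_⟩⟩
  · by_contra! h
    have h₁ := cubic_roots_sum ha0 hb0 hc0 hab.ne (hab.trans hbc).ne hbc.ne
    have h₂ := cubic_roots_sum ha0 hb0 hx hab.ne h.1.symm h.2.1.symm
    exact h.2.2 (by linarith)
  · rintro (rfl | rfl | rfl) <;> assumption

/-- The lens equation in real coordinates: the solutions are the real zeros of a cubic and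
two non-real points. -/
lemma lens_equation_iff (z : ℂ) :
    (starRingEnd ℂ z) * (z ^ 2 - 1 / 2) = z - 1 / 30 ↔
      (30 * z.re ^ 3 - 45 * z.re + 1 = 0 ∧ z.im = 0) ∨
        (z.re = 1 / 30 ∧ z.im ^ 2 = 449 / 900) := by
  obtain ⟨x, y⟩ := z
  have key : (starRingEnd ℂ ⟨x, y⟩) * ((⟨x, y⟩ : ℂ) ^ 2 - 1 / 2) = ⟨x, y⟩ - 1 / 30 ↔
      x * (x ^ 2 + y ^ 2 - 3 / 2) = -1 / 30 ∧ y * (x ^ 2 + y ^ 2 - 1 / 2) = 0 := by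
    have h2 : (1 / 2 : ℂ) = ⟨1 / 2, 0⟩ := by apply Complex.ext <;> norm_num
    have h30 : (1 / 30 : ℂ) = ⟨1 / 30, 0⟩ := by apply Complex.ext <;> norm_num
    rw [h2, h30, Complex.ext_iff]
    simp only [pow_two, Complex.mul_re, Complex.mul_im, Complex.sub_re, Complex.sub_im,
      Complex.conj_re, Complex.conj_im]
    constructor <;> rintro ⟨h₁, h₂⟩ <;> constructor <;> linarith
  rw [key]
  dsimp only
  constructor
  · rintro ⟨h₁, h₂⟩
    rcases mul_eq_zero.1 h₂ with rfl | h
    · exact Or.inl ⟨by linarith, rfl⟩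
    · have hx : x = 1 / 30 := by linear_combination x * h - h₁
      subst hx
      exact Or.inr ⟨rfl, by linarith⟩
  · rintro (⟨h, rfl⟩ | ⟨rfl, h⟩)
    · constructor <;> linarith
    · rw [h]
      norm_num

/-- The lens equation `conj(z) (z² - 1/2) = z - 1/30` has exactly 5 solutions. -/
theorem stmt_8 :
    ({z : ℂ | (starRingEnd ℂ z) * (z ^ 2 - 1 / 2) = z - 1 / 30}).Finite ∧
    ({z : ℂ | (starRingEnd ℂ z) * (z ^ 2 - 1 / 2) = z - 1 / 30}).ncard = 5 := by
  obtain ⟨a, b, c, hab, hbc, hroots⟩ := cubic_real_roots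
  obtain ⟨s, hs, hs2⟩ : ∃ s : ℝ, 0 < s ∧ s ^ 2 = 449 / 900 :=
    ⟨√(449 / 900), by positivity, Real.sq_sqrt (by norm_num)⟩
  have hset : {z : ℂ | (starRingEnd ℂ z) * (z ^ 2 - 1 / 2) = z - 1 / 30} =
      (({⟨a, 0⟩, ⟨b, 0⟩, ⟨c, 0⟩, ⟨1 / 30, s⟩, ⟨1 / 30, -s⟩} : Finset ℂ) : Set ℂ) := by
    ext z
    rw [Set.mem_ofPred_eq, lens_equation_iff, hroots, ← hs2, sq_eq_sq_iff_eq_or_eq_neg]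
    simp only [Finset.coe_insert, Finset.coe_singleton, Set.mem_insert_iff,
      Set.mem_singleton_iff, Complex.ext_iff]
    tauto
  rw [hset, Set.ncard_coe_finset]
  refine ⟨Finset.finite_toSet _, ?_⟩
  have hs_neg : s ≠ -s := (neg_lt_self hs).ne'
  repeat rw [Finset.card_insert_of_notMem]
  · simp
  all_goals simp [hab.ne, hbc.ne, (hab.trans hbc).ne, hs.ne, hs_neg, hs.ne']
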